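/- Assume the number of voters n ≥ 3 is odd. The Condorcet rule is the only strategyproof, non-imposing, and 0-randomly dictatorial SDS on the Condorcet domain D_C; i.e., if f is a strategyproof and non-imposing SDS on D_C that cannot be written as f = γ·d + (1−γ)·g for any γ > 0, random dictatorship d, and strategyproof SDS g on D_C, then f = COND. -/

import Mathlib

open scoped Classical
open Finset

/-- A preference relation: a complete, transitive, and antisymmetric binary relation. -/
def IsPref {A : Type*} (r : A → A → Prop) : Prop :=
  (∀ x y : A, x ≠ y → r x y ∨ r y x) ∧
  (∀ x y z : A, r x y → r y z → r x z) ∧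
  (∀ x y : A, r x y → ¬ r y x)

/-- A preference profile for `n` voters over alternatives `A`. -/
abbrev Prof (n : ℕ) (A : Type*) := Fin n → A → A → Prop

/-- Every voter's relation is a preference relation. -/
def IsProf {n : ℕ} {A : Type*} (R : Prof n A) : Prop := ∀ i, IsPref (R i)

/-- The majority margin `g_R(x,y)`. -/
noncomputable def margin {n : ℕ} {A : Type*} (R : Prof n A) (x y : A) : ℤ :=
  (Nat.card {i : Fin n // R i x y} : ℤ) - (Nat.card {i : Fin n // R i y x} : ℤ)

/-- `x` is the Condorcet winner of `R`. -/
def CondorcetWinner {n : ℕ} {A : Type*} (R : Prof n A) (x : A) : Prop :=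
  ∀ y, y ≠ x → 0 < margin R x y

/-- The Condorcet domain: all profiles admitting a Condorcet winner. -/
def CondorcetDomain (n : ℕ) (A : Type*) : Set (Prof n A) :=
  {R | IsProf R ∧ ∃ x, CondorcetWinner R x}

/-- The `(n+1)`-voter profile `(R, ▷)` obtained from `R` by adding `t` as an extra voter. -/
def tieProf {n : ℕ} {A : Type*} (R : Prof n A) (t : A → A → Prop) : Prof (n + 1) A :=
  Fin.cons t R

/-- The tie-breaking Condorcet domain `D_C^▷`. -/
def TieCondorcetDomain (n : ℕ) {A : Type*} (t : A → A → Prop) : Set (Prof n A) :=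
  {R | IsProf R ∧ ∃ x, CondorcetWinner (tieProf R t) x}

/-- Upper contour set `U(≻, x)`. -/
def UC {A : Type*} (r : A → A → Prop) (x : A) : Set A := {y | r y x ∨ y = x}

/-- Probability that the lottery `p` assigns to the set `S`. -/
noncomputable def mass {A : Type*} [Fintype A] (p : A → ℝ) (S : Set A) : ℝ :=
  ∑ y, S.indicator p y

/-- Stochastic dominance `p ≿^SD q` w.r.t. the preference relation `r`. -/
def SDdom {A : Type*} [Fintype A] (r : A → A → Prop) (p q : A → ℝ) : Prop :=
  ∀ x, mass q (UC r x) ≤ mass p (UC r x)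

/-- `f` is a social decision scheme on the domain `D`: on `D` it returns lotteries. -/
def IsSDS {n : ℕ} {A : Type*} [Fintype A] (D : Set (Prof n A))
    (f : Prof n A → A → ℝ) : Prop :=
  ∀ R ∈ D, (∀ x, 0 ≤ f R x) ∧ (∑ x, f R x) = 1

/-- Strategyproofness of `f` on `D`. -/
def Strategyproof {n : ℕ} {A : Type*} [Fintype A] (D : Set (Prof n A))
    (f : Prof n A → A → ℝ) : Prop :=
  ∀ R ∈ D, ∀ R' ∈ D, ∀ i : Fin n,
    (∀ j, j ≠ i → R j = R' j) → SDdom (R i) (f R) (f R')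

/-- Group-strategyproofness of `f` on `D`. -/
def GroupStrategyproof {n : ℕ} {A : Type*} [Fintype A] (D : Set (Prof n A))
    (f : Prof n A → A → ℝ) : Prop :=
  ∀ R ∈ D, ∀ R' ∈ D, ∀ I : Finset (Fin n), I.Nonempty →
    (∀ j ∉ I, R j = R' j) → ∃ i ∈ I, SDdom (R i) (f R) (f R')

/-- Non-imposition of `f` on `D`. -/
def NonImposing {n : ℕ} {A : Type*} [Fintype A] (D : Set (Prof n A))
    (f : Prof n A → A → ℝ) : Prop :=
  ∀ x : A, ∃ R ∈ D, f R x = 1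

/-- Ex post efficiency of `f` on `D`. -/
def ExPostEfficient {n : ℕ} {A : Type*} [Fintype A] (D : Set (Prof n A))
    (f : Prof n A → A → ℝ) : Prop :=
  ∀ R ∈ D, ∀ x y : A, (∀ i, R i x y) → f R y = 0

/-- `x` is top-ranked by the preference relation `r`. -/
def TopRanked {A : Type*} (r : A → A → Prop) (x : A) : Prop := ∀ y, y ≠ x → r x y

/-- The dictatorship of voter `i`. -/
noncomputable def dict {n : ℕ} {A : Type*} [Fintype A] (i : Fin n) (R : Prof n A) : A → ℝ :=
  fun x => if TopRanked (R i) x then 1 else 0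

/-- The Condorcet rule `COND`. -/
noncomputable def CondRule {n : ℕ} {A : Type*} [Fintype A] : Prof n A → A → ℝ :=
  fun R x => if CondorcetWinner R x then 1 else 0

/-- The tie-breaking Condorcet rule `COND^▷`. -/
noncomputable def TieCondRule {n : ℕ} {A : Type*} [Fintype A] (t : A → A → Prop) :
    Prof n A → A → ℝ :=
  fun R x => if CondorcetWinner (tieProf R t) x then 1 else 0

/-- The relation obtained from `r` by swapping the (adjacent) alternatives `x ≻ y`. -/
def swapRel {A : Type*} (r : A → A → Prop) (x y : A) : A → A → Prop :=
  fun a b => (a = y ∧ b = x) ∨ (r a b ∧ ¬(a = x ∧ b = y))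

/-- `R'` arises from `R` by letting voter `i` swap the adjacent alternatives `x ≻_i y`,
i.e., `R' = R^{i:yx}`. -/
def AdjSwap {n : ℕ} {A : Type*} (R R' : Prof n A) (i : Fin n) (x y : A) : Prop :=
  x ≠ y ∧ R i x y ∧ (∀ z, z ≠ x → z ≠ y → ¬(R i x z ∧ R i z y)) ∧
  R' i = swapRel (R i) x y ∧ (∀ j, j ≠ i → R' j = R j)

/-- A single ad-path step inside `D`. -/
def Step {n : ℕ} {A : Type*} (D : Set (Prof n A)) (R R' : Prof n A) : Prop :=
  R ∈ D ∧ R' ∈ D ∧ ∃ i x y, AdjSwap R R' i x y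

/-- A single ad-path step inside `D` in which the alternative `a` is not swapped. -/
def StepAvoiding {n : ℕ} {A : Type*} (D : Set (Prof n A)) (a : A) (R R' : Prof n A) : Prop :=
  R ∈ D ∧ R' ∈ D ∧ ∃ i x y, AdjSwap R R' i x y ∧ x ≠ a ∧ y ≠ a

/-- There is an ad-path from `R` to `R'` inside `D`. -/
def AdPath {n : ℕ} {A : Type*} (D : Set (Prof n A)) (R R' : Prof n A) : Prop :=
  R ∈ D ∧ R' ∈ D ∧ Relation.ReflTransGen (Step D) R R'

/-- There is an ad-path from `R` to `R'` inside `D` along which `a` is never swapped. -/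
def AdPathAvoiding {n : ℕ} {A : Type*} (D : Set (Prof n A)) (a : A) (R R' : Prof n A) : Prop :=
  R ∈ D ∧ R' ∈ D ∧ Relation.ReflTransGen (StepAvoiding D a) R R'

/-- `D` is weakly connected. -/
def WeaklyConnected {n : ℕ} {A : Type*} (D : Set (Prof n A)) : Prop :=
  ∀ R ∈ D, ∀ R' ∈ D, AdPath D R R'

/-- `D` is connected. -/
def Connected {n : ℕ} {A : Type*} (D : Set (Prof n A)) : Prop :=
  WeaklyConnected D ∧
  ∀ a : A, ∀ R ∈ D, ∀ R' ∈ D, (∀ i, UC (R i) a = UC (R' i) a) → AdPathAvoiding D a R R'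

section Auxiliary

variable {n : ℕ} {A : Type*}

theorem IsPref.irrefl {r : A → A → Prop} (h : IsPref r) (a : A) : ¬ r a a :=
  fun haa => h.2.2 a a haa haa

/-- The relation that compares levels first and breaks ties by `r`. -/
def lexRel (l : A → ℕ) (r : A → A → Prop) : A → A → Prop :=
  fun a b => l a < l b ∨ (l a = l b ∧ r a b)

theorem IsPref.lexRel {r : A → A → Prop} (h : IsPref r) (l : A → ℕ) : IsPref (lexRel l r) := by
  obtain ⟨h1, h2, h3⟩ := h
  refine ⟨fun x y hxy => ?_, fun x y z hxy hyz => ?_, fun x y hxy hyx => ?_⟩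
  · rcases lt_trichotomy (l x) (l y) with h | h | h
    · exact Or.inl (Or.inl h)
    · rcases h1 x y hxy with h' | h'
      · exact Or.inl (Or.inr ⟨h, h'⟩)
      · exact Or.inr (Or.inr ⟨h.symm, h'⟩)
    · exact Or.inr (Or.inl h)
  · rcases hxy with h | ⟨h, h'⟩ <;> rcases hyz with g | ⟨g, g'⟩
    · exact Or.inl (by omega)
    · exact Or.inl (by omega)
    · exact Or.inl (by omega)
    · exact Or.inr ⟨by omega, h2 _ _ _ h' g'⟩
  · rcases hxy with h | ⟨h, h'⟩ <;> rcases hyx with g | ⟨g, g'⟩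
    · omega
    · omega
    · omega
    · exact h3 _ _ h' g'

/-- `a`, `b`, `c` are moved to the first three places. -/
noncomputable def topThree (r : A → A → Prop) (a b c : A) : A → A → Prop :=
  lexRel (fun t => if t = a then 0 else if t = b then 1 else if t = c then 2 else 3) r

/-- `a` is moved to the first place. -/
noncomputable def toTop (r : A → A → Prop) (a : A) : A → A → Prop :=
  lexRel (fun t => if t = a then 0 else 1) r

/-- `a` is moved to the last place. -/
noncomputable def toBot (r : A → A → Prop) (a : A) : A → A → Prop :=
  lexRel (fun t => if t = a then 1 else 0) r

theorem topThree_apply (r : A → A → Prop) (a b c s t : A) :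
    topThree r a b c s t ↔
      (if s = a then 0 else if s = b then 1 else if s = c then 2 else 3) <
        (if t = a then 0 else if t = b then 1 else if t = c then 2 else 3) ∨
      (if s = a then 0 else if s = b then 1 else if s = c then 2 else 3) =
        (if t = a then 0 else if t = b then 1 else if t = c then 2 else 3) ∧ r s t := Iff.rfl

theorem toTop_apply (r : A → A → Prop) (a s t : A) :
    toTop r a s t ↔ (if s = a then 0 else 1) < (if t = a then 0 else 1) ∨
      (if s = a then 0 else 1) = (if t = a then 0 else 1) ∧ r s t := Iff.rfl

theorem toBot_apply (r : A → A → Prop) (a s t : A) :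
    toBot r a s t ↔ (if s = a then 1 else 0) < (if t = a then 1 else 0) ∨
      (if s = a then 1 else 0) = (if t = a then 1 else 0) ∧ r s t := Iff.rfl

theorem IsPref.topThree {r : A → A → Prop} (h : IsPref r) (a b c : A) :
    IsPref (topThree r a b c) := h.lexRel _

theorem IsPref.toTop {r : A → A → Prop} (h : IsPref r) (a : A) : IsPref (toTop r a) := h.lexRel _

theorem IsPref.toBot {r : A → A → Prop} (h : IsPref r) (a : A) : IsPref (toBot r a) := h.lexRel _

theorem IsPref.exists_topRanked [Finite A] [Nonempty A] {r : A → A → Prop} (h : IsPref r) :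
    ∃ t, TopRanked r t := by
  have : IsTrans A r := ⟨h.2.1⟩
  have : Std.Irrefl r := ⟨h.irrefl⟩
  obtain ⟨t, -, ht⟩ := (Finite.wellFounded_of_trans_of_irrefl r).has_min Set.univ Set.univ_nonempty
  exact ⟨t, fun y hy => (h.1 t y hy.symm).resolve_right (ht y trivial)⟩

theorem IsPref.topRanked_unique {r : A → A → Prop} (h : IsPref r) {a b : A}
    (ha : TopRanked r a) (hb : TopRanked r b) : a = b := by
  by_contra hab
  exact h.2.2 _ _ (ha b (Ne.symm hab)) (hb a hab)

/-- The number of voters preferring `x` to `y`. -/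
noncomputable def support (R : Prof n A) (x y : A) : ℕ := #{i | R i x y}

theorem margin_eq (R : Prof n A) (x y : A) :
    margin R x y = (support R x y : ℤ) - support R y x := by
  simp [margin, support, Nat.card_eq_fintype_card, Fintype.card_subtype]

theorem support_add {R : Prof n A} (hR : IsProf R) {x y : A} (h : x ≠ y) :
    support R x y + support R y x = n := by
  have h1 := Finset.card_filter_add_card_filter_not (s := (univ : Finset (Fin n)))
    (fun i => R i x y)
  have h2 : (univ.filter fun i => ¬ R i x y) = univ.filter fun i => R i y x := by
    ext i
    simp only [mem_filter, mem_univ, true_and]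
    exact ⟨fun h' => ((hR i).1 x y h).resolve_left h', fun h' => (hR i).2.2 _ _ h'⟩
  rw [h2] at h1
  simpa [support] using h1

theorem condorcetWinner_iff {R : Prof n A} (hR : IsProf R) (x : A) :
    CondorcetWinner R x ↔ ∀ y, y ≠ x → n < 2 * support R x y := by
  refine forall₂_congr fun y hy => ?_
  have := support_add hR hy.symm
  rw [margin_eq]
  omega

theorem le_support {R : Prof n A} {O : Finset (Fin n)} {x y : A} (h : ∀ i ∈ O, R i x y) :
    #O ≤ support R x y :=
  Finset.card_le_card fun i hi => by simpa using h i hi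

theorem condorcetWinner_unique {R : Prof n A} {x y : A}
    (hx : CondorcetWinner R x) (hy : CondorcetWinner R y) : x = y := by
  by_contra h
  have h1 := hx y (Ne.symm h)
  have h2 := hy x h
  rw [margin_eq] at h1 h2
  omega

/-- `x` is ranked at least as high in `r` as voter `i` ranks it in `R₀`. -/
def Lifts (R₀ : Prof n A) (x : A) (i : Fin n) (r : A → A → Prop) : Prop :=
  IsPref r ∧ ∀ y, R₀ i x y → r x y

/-- Voters in `O` rank `x` first. -/
def TopOn (O : Finset (Fin n)) (x : A) (i : Fin n) (r : A → A → Prop) : Prop :=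
  IsPref r ∧ (i ∈ O → TopRanked r x)

/-- Voters in `O` rank `x` and `y` above everything else. -/
def PairOn (O : Finset (Fin n)) (x y : A) (i : Fin n) (r : A → A → Prop) : Prop :=
  IsPref r ∧ (i ∈ O → ∀ z, z ≠ x → z ≠ y → r x z ∧ r y z)

theorem condorcetWinner_of_lifts {R₀ R : Prof n A} {x : A} (h₀ : IsProf R₀)
    (hx : CondorcetWinner R₀ x) (h : ∀ i, Lifts R₀ x i (R i)) : CondorcetWinner R x := by
  rw [condorcetWinner_iff h₀] at hx
  rw [condorcetWinner_iff fun i => (h i).1]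
  intro y hy
  have : support R₀ x y ≤ support R x y :=
    Finset.card_le_card fun i hi => by simpa using (h i).2 y (by simpa using hi)
  have := hx y hy
  omega

theorem mem_of_lifts {R₀ : Prof n A} {x : A} (h₀ : IsProf R₀) (hx : CondorcetWinner R₀ x)
    (R : Prof n A) (h : ∀ i, Lifts R₀ x i (R i)) : R ∈ CondorcetDomain n A :=
  ⟨fun i => (h i).1, x, condorcetWinner_of_lifts h₀ hx h⟩

theorem condorcetWinner_of_topOn {O : Finset (Fin n)} {x : A} (hO : n < 2 * #O)
    {R : Prof n A} (h : ∀ i, TopOn O x i (R i)) : CondorcetWinner R x := by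
  rw [condorcetWinner_iff fun i => (h i).1]
  intro y hy
  have := le_support (R := R) (x := x) (y := y) fun i hi => (h i).2 hi y hy
  omega

theorem mem_of_topOn {O : Finset (Fin n)} {x : A} (hO : n < 2 * #O)
    (R : Prof n A) (h : ∀ i, TopOn O x i (R i)) : R ∈ CondorcetDomain n A :=
  ⟨fun i => (h i).1, x, condorcetWinner_of_topOn hO h⟩

theorem mem_of_pairOn (hodd : Odd n) {O : Finset (Fin n)} {x y : A} (hO : n < 2 * #O)
    (R : Prof n A) (h : ∀ i, PairOn O x y i (R i)) : R ∈ CondorcetDomain n A := by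
  have hR : IsProf R := fun i => (h i).1
  refine ⟨hR, ?_⟩
  have hx : ∀ z, z ≠ x → z ≠ y → n < 2 * support R x z ∧ n < 2 * support R y z := by
    intro z hzx hzy
    have h1 := le_support (R := R) fun i hi => ((h i).2 hi z hzx hzy).1
    have h2 := le_support (R := R) fun i hi => ((h i).2 hi z hzx hzy).2
    omega
  by_cases hxy : x = y
  · subst hxy
    exact ⟨x, (condorcetWinner_iff hR x).2 fun z hz => (hx z hz hz).1⟩
  have hsum := support_add hR hxy
  obtain ⟨k, hk⟩ := hodd
  rcases lt_or_ge n (2 * support R x y) with hlt | hge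
  · refine ⟨x, (condorcetWinner_iff hR x).2 fun z hz => ?_⟩
    by_cases hzy : z = y
    · rwa [hzy]
    · exact (hx z hz hzy).1
  · refine ⟨y, (condorcetWinner_iff hR y).2 fun z hz => ?_⟩
    by_cases hzx : z = x
    · rw [hzx]; omega
    · exact (hx z hzx hz).2

/-- The profile in which the voters in `S` have switched from `R` to `R'`. -/
noncomputable def hybrid (S : Finset (Fin n)) (R R' : Prof n A) : Prof n A :=
  fun i => if i ∈ S then R' i else R i

theorem hybrid_induction {R R' : Prof n A} {K : Fin n → (A → A → Prop) → Prop}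
    {D : Set (Prof n A)} (hK : ∀ Q : Prof n A, (∀ i, K i (Q i)) → Q ∈ D)
    (hR : ∀ i, K i (R i)) (hR' : ∀ i, K i (R' i)) (u : Prof n A → ℝ)
    (step : ∀ Q ∈ D, ∀ Q' ∈ D, ∀ i, (∀ j, j ≠ i → Q j = Q' j) → Q i = R i → Q' i = R' i →
      u Q' ≤ u Q) : u R' ≤ u R := by
  have hmem : ∀ S, hybrid S R R' ∈ D := fun S => hK _ fun i => by
    unfold hybrid
    split_ifs
    exacts [hR' i, hR i]
  have key : ∀ S : Finset (Fin n), u (hybrid S R R') ≤ u R := by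
    intro S
    induction S using Finset.induction_on with
    | empty => exact le_of_eq (by congr 1)
    | insert i S hi ih =>
      refine le_trans (step _ (hmem _) _ (hmem _) i ?_ ?_ ?_) ih
      · intro j hj
        simp [hybrid, hj]
      · simp [hybrid, hi]
      · simp [hybrid]
  have := key univ
  rwa [show hybrid univ R R' = R' by funext i; simp [hybrid]] at this

variable [Fintype A]

theorem mass_insert (p : A → ℝ) {S : Set A} {y : A} (hy : y ∉ S) :
    mass p (insert y S) = p y + mass p S := by
  have : ∀ z, (insert y S : Set A).indicator p z = (if z = y then p y else 0) + S.indicator p z := by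
    intro z
    by_cases hz : z = y
    · subst hz; simp [hy]
    · by_cases hzS : z ∈ S <;> simp [Set.indicator, hz, hzS]
  simp [mass, this, Finset.sum_add_distrib]

variable {D : Set (Prof n A)} {f : Prof n A → A → ℝ}

theorem Strategyproof.mass_le (hsp : Strategyproof D f) {R R' : Prof n A} (hR : R ∈ D)
    (hR' : R' ∈ D) {i : Fin n} (hi : ∀ j, j ≠ i → R j = R' j) (hp : IsPref (R i)) {S : Set A}
    (hS : ∀ a ∈ S, ∀ b, R i b a → b ∈ S) : mass (f R') S ≤ mass (f R) S := by
  rcases S.eq_empty_or_nonempty with rfl | hne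
  · simp [mass]
  have : IsTrans A (fun a b => R i b a) := ⟨fun a b c h1 h2 => hp.2.1 _ _ _ h2 h1⟩
  have : Std.Irrefl (fun a b => R i b a) := ⟨hp.irrefl⟩
  obtain ⟨a, haS, ha⟩ :=
    (Finite.wellFounded_of_trans_of_irrefl (fun a b => R i b a)).has_min S hne
  have hU : UC (R i) a = S := by
    ext b
    constructor
    · rintro (hb | rfl)
      exacts [hS a haS b hb, haS]
    · intro hb
      by_cases hba : b = a
      · exact Or.inr hba
      · exact Or.inl ((hp.1 b a hba).resolve_right (ha b hb))
  have := hsp R hR R' hR' i hi a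
  rwa [hU] at this

theorem Strategyproof.apply_le_of_deviation (hsp : Strategyproof D f) {R R' : Prof n A}
    (hR : R ∈ D) (hR' : R' ∈ D) {i : Fin n} (hi : ∀ j, j ≠ i → R j = R' j) (hp : IsPref (R i))
    (hp' : IsPref (R' i)) {y : A} (hS : ∀ a, R i a y → ∀ b, R' i b a → R i b y) :
    f R' y ≤ f R y := by
  have h1 := hsp.mass_le hR' hR (fun j hj => (hi j hj).symm) hp' (S := {a | R i a y}) hS
  have h2 := hsp.mass_le hR hR' hi hp (S := insert y {a | R i a y}) (by
    rintro a (rfl | ha) b hb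
    · exact Or.inr hb
    · exact Or.inr (hp.2.1 _ _ _ hb ha))
  rw [mass_insert _ (by simpa using hp.irrefl y), mass_insert _ (by simpa using hp.irrefl y)] at h2
  linarith

theorem Strategyproof.apply_le (hsp : Strategyproof D f)
    {K : Fin n → (A → A → Prop) → Prop} (hK : ∀ Q : Prof n A, (∀ i, K i (Q i)) → Q ∈ D)
    {R R' : Prof n A} (hpR : IsProf R) (hpR' : IsProf R')
    (hR : ∀ i, K i (R i)) (hR' : ∀ i, K i (R' i)) {y : A}
    (hS : ∀ i a, R i a y → ∀ b, R' i b a → R i b y) : f R' y ≤ f R y := by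
  refine hybrid_induction hK hR hR' (fun Q => f Q y) fun Q hQ Q' hQ' i hi h1 h2 => ?_
  refine hsp.apply_le_of_deviation hQ hQ' hi (h1 ▸ hpR i) (h2 ▸ hpR' i) ?_
  rw [h1, h2]
  exact hS i

theorem Strategyproof.apply_eq (hsp : Strategyproof D f)
    {K : Fin n → (A → A → Prop) → Prop} (hK : ∀ Q : Prof n A, (∀ i, K i (Q i)) → Q ∈ D)
    {R R' : Prof n A} (hpR : IsProf R) (hpR' : IsProf R')
    (hR : ∀ i, K i (R i)) (hR' : ∀ i, K i (R' i)) {y : A}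
    (hS : ∀ i a, R i a y ↔ R' i a y) : f R y = f R' y := by
  apply le_antisymm
  · exact hsp.apply_le hK hpR' hpR hR' hR fun i a ha b hb =>
      (hS i b).1 ((hpR i).2.1 _ _ _ hb ((hS i a).2 ha))
  · exact hsp.apply_le hK hpR hpR' hR hR' fun i a ha b hb =>
      (hS i b).2 ((hpR' i).2.1 _ _ _ hb ((hS i a).1 ha))

end Auxiliary

section Unanimous

variable {n : ℕ} {A : Type*}

/-- The two-block profile in which voters in `I` rank `y` first and `x` second, and the others
rank `x` first and `y` second. -/
noncomputable def blockProf (r : A → A → Prop) (y x : A) (I : Finset (Fin n)) : Prof n A :=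
  fun i => if i ∈ I then topThree r y x x else topThree r x y y

theorem isProf_blockProf {r : A → A → Prop} (hr : IsPref r) (y x : A) (I : Finset (Fin n)) :
    IsProf (blockProf r y x I) := fun i => by
  unfold blockProf
  split_ifs <;> exact hr.topThree _ _ _

theorem topRanked_topThree (r : A → A → Prop) (a b c : A) : TopRanked (topThree r a b c) a :=
  fun y hy => by simp [topThree_apply, hy]; split_ifs <;> simp

theorem topRanked_toTop (r : A → A → Prop) (a : A) : TopRanked (toTop r a) a :=
  fun y hy => by simp [toTop_apply, hy]

variable [Fintype A]

/-- A strategyproof social decision scheme on the Condorcet domain for an odd number of voters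
that respects unanimous top choices. -/
structure UnanimousScheme (f : Prof n A → A → ℝ) : Prop where
  odd : Odd n
  sds : IsSDS (CondorcetDomain n A) f
  sp : Strategyproof (CondorcetDomain n A) f
  unanimous : ∀ R x, IsProf R → (∀ i, TopRanked (R i) x) → f R x = 1

variable {f : Prof n A → A → ℝ}

theorem IsSDS.apply_le_one {D : Set (Prof n A)} (hf : IsSDS D f) {R : Prof n A} (hR : R ∈ D)
    (x : A) : f R x ≤ 1 := by
  rw [← (hf R hR).2]
  exact Finset.single_le_sum (fun y _ => (hf R hR).1 y) (mem_univ x)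

theorem IsSDS.add_eq_one {D : Set (Prof n A)} (hf : IsSDS D f) {R : Prof n A} (hR : R ∈ D)
    {x y : A} (hxy : x ≠ y) (h : ∀ z, z ≠ x → z ≠ y → f R z = 0) : f R x + f R y = 1 := by
  rw [← (hf R hR).2, ← Finset.sum_pair hxy]
  refine Finset.sum_subset (Finset.subset_univ _) fun z _ hz => ?_
  simp only [mem_insert, mem_singleton, not_or] at hz
  exact h z hz.1 hz.2

theorem IsSDS.add_add_eq_one {D : Set (Prof n A)} (hf : IsSDS D f) {R : Prof n A} (hR : R ∈ D)
    {x y z : A} (hxy : x ≠ y) (hxz : x ≠ z) (hyz : y ≠ z)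
    (h : ∀ a, a ≠ x → a ≠ y → a ≠ z → f R a = 0) : f R x + f R y + f R z = 1 := by
  have h3 : ∑ a ∈ ({x, y, z} : Finset A), f R a = f R x + f R y + f R z := by
    rw [Finset.sum_insert (by simp [hxy, hxz]), Finset.sum_pair hyz, add_assoc]
  rw [← (hf R hR).2, ← h3]
  refine Finset.sum_subset (Finset.subset_univ _) fun a _ ha => ?_
  simp only [mem_insert, mem_singleton, not_or] at ha
  exact h a ha.1 ha.2.1 ha.2.2

theorem UnanimousScheme.of_nonImposing (hn : 3 ≤ n) (hodd : Odd n)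
    (hf : IsSDS (CondorcetDomain n A) f) (hsp : Strategyproof (CondorcetDomain n A) f)
    (hni : NonImposing (CondorcetDomain n A) f) : UnanimousScheme f := by
  refine ⟨hodd, hf, hsp, fun T x hT hTx => ?_⟩
  obtain ⟨R, ⟨hR, z, hz⟩, hRx⟩ := hni x
  have huniv : n < 2 * #(univ : Finset (Fin n)) := by rw [Finset.card_fin]; omega
  let Ra : Prof n A := fun i => if R i z x then toTop (R i) z else R i
  let R₁ : Prof n A := fun i => if R i z x then topThree (R i) z x x else topThree (R i) x z z
  let R₂ : Prof n A := fun i => topThree (R i) x z z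
  have hRa : IsProf Ra := fun i => by
    simp only [Ra]; split_ifs; exacts [(hR i).toTop _, hR i]
  have hR₁ : IsProf R₁ := fun i => by
    simp only [R₁]; split_ifs <;> exact (hR i).topThree _ _ _
  have hR₂ : IsProf R₂ := fun i => (hR i).topThree _ _ _
  have l0 : ∀ i, Lifts R z i (R i) := fun i => ⟨hR i, fun _ h => h⟩
  have la : ∀ i, Lifts R z i (Ra i) := fun i => ⟨hRa i, fun y h => by
    have := (hR i).irrefl z
    simp only [Ra, ite_apply, toTop_apply]; grind⟩
  have l1 : ∀ i, Lifts R z i (R₁ i) := fun i => ⟨hR₁ i, fun y h => by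
    have := (hR i).irrefl z
    simp only [R₁, ite_apply, topThree_apply]; grind⟩
  have e1 : f R x = f Ra x := hsp.apply_eq (mem_of_lifts hR hz) hR hRa l0 la fun i a => by
    have := (hR i).irrefl x
    simp only [Ra, ite_apply, toTop_apply]; grind
  have e2 : f Ra x ≤ f R₁ x := hsp.apply_le (mem_of_lifts hR hz) hR₁ hRa l1 la
    fun i a ha b hb => by
      have := (hR i).irrefl x
      have := (hR i).irrefl z
      simp only [Ra, R₁, ite_apply, topThree_apply, toTop_apply] at ha hb ⊢; grind
  have e3 : f R₁ x ≤ f R₂ x := by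
    refine hsp.apply_le (mem_of_pairOn hodd huniv (x := x) (y := z)) hR₂ hR₁
      (fun i => ⟨hR₂ i, fun _ y h h' => ?_⟩) (fun i => ⟨hR₁ i, fun _ y h h' => ?_⟩)
      fun i a ha b hb => ?_
    · simp only [R₂, topThree_apply]; grind
    · simp only [R₁, ite_apply, topThree_apply]; grind
    · have := (hR i).irrefl x
      simp only [R₂, topThree_apply] at ha; grind
  have e4 : f R₂ x ≤ f T x := by
    refine hsp.apply_le (mem_of_topOn huniv (x := x)) hT hR₂
      (fun i => ⟨hT i, fun _ => hTx i⟩) (fun i => ⟨hR₂ i, fun _ => topRanked_topThree _ _ _ _⟩)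
      fun i a ha b hb => ?_
    have h1 := (hT i).2.2 a x ha
    have h2 := hTx i a
    have h3 := (hT i).irrefl x
    grind
  have hTD : T ∈ CondorcetDomain n A :=
    mem_of_topOn huniv (x := x) T fun i => ⟨hT i, fun _ => hTx i⟩
  have := hf.apply_le_one hTD x
  linarith

namespace UnanimousScheme

theorem eq_zero_of_condorcetWinner (hf : UnanimousScheme f) {R : Prof n A} (hR : IsProf R)
    {x z : A} (hx : CondorcetWinner R x) (h : ∀ i, R i x z) (hzx : z ≠ x) : f R z = 0 := by
  let R' : Prof n A := fun i => toTop (R i) x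
  have hR' : IsProf R' := fun i => (hR i).toTop x
  have l' : ∀ i, Lifts R x i (R' i) := fun i => ⟨hR' i, fun y hy => topRanked_toTop _ _ _
    fun h => (hR i).irrefl x (h ▸ hy)⟩
  have e : f R z = f R' z := by
    refine hf.sp.apply_eq (mem_of_lifts hR hx) hR hR' (fun i => ⟨hR i, fun _ h => h⟩) l'
      fun i a => ?_
    have := h i
    simp only [R', toTop_apply]; grind
  have hD := mem_of_lifts hR hx R' l'
  have h1 := hf.unanimous R' x hR' fun i => topRanked_toTop _ _
  have h2 := (hf.sds R' hD).2
  have h3 := Finset.sum_le_sum_of_subset_of_nonneg (Finset.subset_univ {x, z})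
    (fun a _ _ => (hf.sds R' hD).1 a)
  rw [Finset.sum_pair hzx.symm] at h3
  have := (hf.sds R' hD).1 z
  linarith

theorem eq_zero_of_pairOn (hf : UnanimousScheme f) {R : Prof n A} (hR : IsProf R)
    {O : Finset (Fin n)} (hO : n < 2 * #O) {x y z : A}
    (hx : ∀ i ∈ O, ∀ z, z ≠ x → z ≠ y → R i x z) (hy : ∀ i z, z ≠ x → z ≠ y → R i y z)
    (hzx : z ≠ x) (hzy : z ≠ y) : f R z = 0 := by
  let R' : Prof n A := fun i => toTop (R i) y
  have hR' : IsProf R' := fun i => (hR i).toTop y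
  have l : ∀ i, PairOn O x y i (R i) := fun i =>
    ⟨hR i, fun hi a h h' => ⟨hx i hi a h h', hy i a h h'⟩⟩
  have l' : ∀ i, PairOn O x y i (R' i) := fun i => ⟨hR' i, fun hi a h h' => by
    have := hx i hi a h h'
    simp only [R', toTop_apply]; grind⟩
  have e : f R z = f R' z := by
    refine hf.sp.apply_eq (mem_of_pairOn hf.odd hO) hR hR' l l' fun i a => ?_
    have := hy i z hzx hzy
    simp only [R', toTop_apply]; grind
  have hD := mem_of_pairOn hf.odd hO R' l'
  have h1 := hf.unanimous R' y hR' fun i => topRanked_toTop _ _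
  have h2 := (hf.sds R' hD).2
  have h3 := Finset.sum_le_sum_of_subset_of_nonneg (Finset.subset_univ {y, z})
    (fun a _ _ => (hf.sds R' hD).1 a)
  rw [Finset.sum_pair hzy.symm] at h3
  have := (hf.sds R' hD).1 z
  linarith

end UnanimousScheme

end Unanimous

section Weights

variable {n : ℕ} {A : Type*}

/-- Voter `i` reports `p`, the voters in `J` report `q`, and everyone else reports `o`. -/
noncomputable def splitProf (i : Fin n) (J : Finset (Fin n)) (p q o : A → A → Prop) : Prof n A :=
  fun j => if j = i then p else if j ∈ J then q else o

theorem isProf_splitProf {i : Fin n} {J : Finset (Fin n)} {p q o : A → A → Prop} (hp : IsPref p)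
    (hq : IsPref q) (ho : IsPref o) : IsProf (splitProf i J p q o) := fun j => by
  unfold splitProf
  split_ifs <;> assumption

theorem splitProf_mem {i : Fin n} {J : Finset (Fin n)}
    (hO : n < 2 * #(insert i J)ᶜ) {x : A} {p q o : A → A → Prop}
    (hp : IsPref p) (hq : IsPref q) (ho : IsPref o) (hx : TopRanked o x) :
    splitProf i J p q o ∈ CondorcetDomain n A := by
  have hR := isProf_splitProf (i := i) (J := J) hp hq ho
  refine mem_of_topOn hO (x := x) _ fun j => ⟨hR j, fun hj => ?_⟩
  simp only [mem_compl, mem_insert, not_or] at hj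
  simpa [splitProf, hj] using hx

theorem blockProf_compl (r : A → A → Prop) (y x : A) (I : Finset (Fin n)) :
    blockProf r x y Iᶜ = blockProf r y x I := by
  funext i
  by_cases hi : i ∈ I <;> simp [blockProf, hi]

variable [Fintype A] {f : Prof n A → A → ℝ} {r : A → A → Prop}

namespace UnanimousScheme

theorem lt_two_mul_card_univ (hf : UnanimousScheme f) : n < 2 * #(univ : Finset (Fin n)) := by
  have := hf.odd.pos
  rw [Finset.card_fin]
  omega

theorem blockProf_mem (hf : UnanimousScheme f) (hr : IsPref r) (y x : A) (I : Finset (Fin n)) :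
    blockProf r y x I ∈ CondorcetDomain n A := by
  refine mem_of_pairOn hf.odd hf.lt_two_mul_card_univ (x := x) (y := y) _ fun i =>
    ⟨isProf_blockProf hr y x I i, fun _ z h h' => ?_⟩
  simp only [blockProf, ite_apply, topThree_apply]
  grind

theorem blockProf_add (hf : UnanimousScheme f) (hr : IsPref r) {y x : A} (hyx : y ≠ x)
    (I : Finset (Fin n)) :
    f (blockProf r y x I) x + f (blockProf r y x I) y = 1 := by
  refine hf.sds.add_eq_one (hf.blockProf_mem hr y x I) hyx.symm fun z hzx hzy => ?_
  refine hf.eq_zero_of_pairOn (isProf_blockProf hr y x I) hf.lt_two_mul_card_univ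
    (x := x) (y := y) (fun i _ z h h' => ?_) (fun i z h h' => ?_) hzx hzy
  all_goals
    simp only [blockProf, ite_apply, topThree_apply]
    grind

theorem apply_eq_blockProf (hf : UnanimousScheme f) (hr : IsPref r) {R : Prof n A}
    (hR : IsProf R) {x y : A} (hx : CondorcetWinner R x) (hyx : y ≠ x) {I : Finset (Fin n)}
    (hI : ∀ i ∈ I, TopRanked (R i) y) (hI' : ∀ i ∉ I, ∀ z, z ≠ y → R i z y) :
    f R y = f (blockProf r y x I) y := by
  let R' : Prof n A := fun i => if i ∈ I then topThree r y x x else toBot (toTop r x) y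
  have hR' : IsProf R' := fun i => by
    simp only [R']; split_ifs; exacts [hr.topThree _ _ _, (hr.toTop _).toBot _]
  have l0 : ∀ i, Lifts R x i (R i) := fun i => ⟨hR i, fun _ h => h⟩
  have l1 : ∀ i, Lifts R x i (R' i) := fun i => ⟨hR' i, fun a ha => by
    have h1 := (hR i).irrefl x
    have h2 := (hR i).2.2 _ _ ha
    have h3 := hI i
    simp only [TopRanked] at h3
    simp only [R', ite_apply, topThree_apply, toBot_apply, toTop_apply]
    grind⟩
  have l2 : ∀ i, Lifts R x i (blockProf r y x I i) := fun i =>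
    ⟨isProf_blockProf hr y x I i, fun a ha => by
      have h1 := (hR i).irrefl x
      have h2 := (hR i).2.2 _ _ ha
      have h3 := hI i
      simp only [TopRanked] at h3
      simp only [blockProf, ite_apply, topThree_apply]
      grind⟩
  have hK := mem_of_lifts hR hx
  have e1 : f R y = f R' y := by
    refine hf.sp.apply_eq hK hR hR' l0 l1 fun i a => ?_
    have h1 := (hR i).irrefl y
    have h2 := (hR i).2.2 a y
    have h3 := hI i
    have h4 := hI' i
    have h5 := hr.irrefl y
    simp only [TopRanked] at h3
    simp only [R', ite_apply, topThree_apply, toBot_apply, toTop_apply]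
    grind
  have e2 : f R' x = f (blockProf r y x I) x := by
    refine hf.sp.apply_eq hK hR' (isProf_blockProf hr y x I) l1 l2 fun i a => ?_
    have h5 := hr.irrefl x
    simp only [R', blockProf, ite_apply, topThree_apply, toBot_apply, toTop_apply]
    grind
  have e3 : f R' x + f R' y = 1 := by
    refine hf.sds.add_eq_one (hK _ l1) hyx.symm fun z hzx hzy => ?_
    refine hf.eq_zero_of_condorcetWinner hR' (condorcetWinner_of_lifts hR hx l1) (fun i => ?_) hzx
    simp only [R', ite_apply, topThree_apply, toBot_apply, toTop_apply]
    grind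
  have e4 := hf.blockProf_add hr hyx I
  linarith

theorem blockProf_le (hf : UnanimousScheme f) (hr : IsPref r) {R : Prof n A}
    (hR : IsProf R) {x y : A} (hx : CondorcetWinner R x) (hyx : y ≠ x) :
    f (blockProf r y x {i | TopRanked (R i) y}) y ≤ f R y := by
  let R' : Prof n A := fun i => if TopRanked (R i) y then R i else toBot (R i) y
  have hR' : IsProf R' := fun i => by
    simp only [R']; split_ifs; exacts [hR i, (hR i).toBot _]
  have l1 : ∀ i, Lifts R x i (R' i) := fun i => ⟨hR' i, fun a ha => by
    simp only [R', ite_apply, toBot_apply]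
    grind⟩
  have e1 : f R' y ≤ f R y := by
    refine hf.sp.apply_le (mem_of_lifts hR hx) hR hR' (fun i => ⟨hR i, fun _ h => h⟩) l1
      fun i a ha b hb => ?_
    have h1 := (hR i).irrefl y
    have h2 := (hR i).2.1 b a y
    simp only [R', ite_apply, toBot_apply] at hb
    grind
  rw [← hf.apply_eq_blockProf hr hR' (condorcetWinner_of_lifts hR hx l1) hyx (fun i hi => ?_)
    fun i hi z hz => ?_]
  · exact e1
  · have hi' : TopRanked (R i) y := by simpa using hi
    simp [R', hi']
  · have hi' : ¬ TopRanked (R i) y := by simpa using hi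
    simp [R', hi', toBot_apply, hz]

theorem blockProf_le_of_topOn (hf : UnanimousScheme f) (hr : IsPref r) {R : Prof n A}
    (hR : IsProf R) {x y : A} (hyx : y ≠ x) {O : Finset (Fin n)} (hO : n < 2 * #O)
    (hx : ∀ i ∈ O, TopRanked (R i) x) : f (blockProf r x y O) x ≤ f R x := by
  let R₁ : Prof n A := fun i => if i ∈ O then R i else toBot (R i) x
  let R₂ : Prof n A := fun i => if i ∈ O then topThree r x y y else toBot (toTop r y) x
  have hR₁ : IsProf R₁ := fun i => by
    simp only [R₁]; split_ifs; exacts [hR i, (hR i).toBot _]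
  have hR₂ : IsProf R₂ := fun i => by
    simp only [R₂]; split_ifs; exacts [hr.topThree _ _ _, (hr.toTop _).toBot _]
  have hK := mem_of_topOn (A := A) (x := x) hO
  have l1 : ∀ i, TopOn O x i (R₁ i) := fun i => ⟨hR₁ i, fun hi => by
    simpa [R₁, hi] using hx i hi⟩
  have l2 : ∀ i, TopOn O x i (R₂ i) := fun i => ⟨hR₂ i, fun hi => by
    simpa [R₂, hi] using topRanked_topThree _ _ _ _⟩
  have l3 : ∀ i, TopOn O x i (blockProf r x y O i) := fun i =>
    ⟨isProf_blockProf hr x y O i, fun hi => by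
      simpa [blockProf, hi] using topRanked_topThree _ _ _ _⟩
  have e1 : f R₁ x ≤ f R x := by
    refine hf.sp.apply_le hK hR hR₁ (fun i => ⟨hR i, hx i⟩) l1 fun i a ha b hb => ?_
    have h1 := (hR i).irrefl x
    have h2 := (hR i).2.1 b a x
    simp only [R₁, ite_apply, toBot_apply] at hb
    grind
  have e2 : f R₁ x = f R₂ x := by
    refine hf.sp.apply_eq hK hR₁ hR₂ l1 l2 fun i a => ?_
    have h1 := (hR i).irrefl x
    have h2 := hr.irrefl x
    have h3 := (hR i).2.2 a x
    have h4 := hx i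
    simp only [TopRanked] at h4
    simp only [R₁, R₂, ite_apply, toBot_apply, toTop_apply, topThree_apply]
    grind
  have e3 : f R₂ y = f (blockProf r x y O) y := by
    refine hf.sp.apply_eq hK hR₂ (isProf_blockProf hr x y O) l2 l3 fun i a => ?_
    have h2 := hr.irrefl y
    simp only [R₂, blockProf, ite_apply, toBot_apply, toTop_apply, topThree_apply]
    grind
  have e4 : f R₂ x + f R₂ y = 1 := by
    refine hf.sds.add_eq_one (hK _ l2) hyx.symm fun z hzx hzy => ?_
    refine hf.eq_zero_of_pairOn hR₂ hO (x := x) (y := y) (fun i _ z h h' => ?_)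
      (fun i z h h' => ?_) hzx hzy
    all_goals
      simp only [R₂, ite_apply, toBot_apply, toTop_apply, topThree_apply]
      grind
  have e5 := hf.blockProf_add hr hyx.symm O
  linarith

theorem blockProf_eq_of_ne_left (hf : UnanimousScheme f) (hr : IsPref r) {x y z : A}
    (hyx : y ≠ x) (hzx : z ≠ x) (hyz : y ≠ z) {I : Finset (Fin n)} (hI : 2 * #I < n) :
    f (blockProf r y x I) y = f (blockProf r z x I) z := by
  have hO : n < 2 * #Iᶜ := by rw [Finset.card_compl, Fintype.card_fin]; omega
  have hK := mem_of_topOn (A := A) (x := x) hO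
  let B : A → A → Prof n A := fun y z i => if i ∈ I then topThree r y z x else topThree r x y z
  have hB : ∀ y z, IsProf (B y z) := fun y z i => by
    simp only [B]; split_ifs <;> exact hr.topThree _ _ _
  have lB : ∀ y z i, TopOn Iᶜ x i (B y z i) := fun y z i => ⟨hB y z i, fun hi => by
    simpa [B, Finset.mem_compl.1 hi] using topRanked_topThree _ _ _ _⟩
  have lP : ∀ y i, TopOn Iᶜ x i (blockProf r y x I i) := fun y i =>
    ⟨isProf_blockProf hr y x I i, fun hi => by
      simpa [blockProf, Finset.mem_compl.1 hi] using topRanked_topThree _ _ _ _⟩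
  have key : ∀ y z, y ≠ x → z ≠ x → y ≠ z → f (B y z) x + f (blockProf r y x I) y = 1 := by
    intro y z hyx hzx hyz
    have e1 : f (B y z) y = f (blockProf r y x I) y := by
      refine hf.sp.apply_eq hK (hB y z) (isProf_blockProf hr y x I) (lB y z) (lP y) fun i a => ?_
      have h2 := hr.irrefl y
      simp only [B, blockProf, ite_apply, topThree_apply]
      grind
    rw [← e1]
    refine hf.sds.add_eq_one (hK _ (lB y z)) hyx.symm fun a hax hay => ?_
    refine hf.eq_zero_of_pairOn (hB y z) hO (x := x) (y := y) (fun i hi z h h' => ?_)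
      (fun i z h h' => ?_) hax hay
    · exact (lB y _ i).2 hi z h
    · simp only [B, ite_apply, topThree_apply]
      grind
  have e : f (B y z) x = f (B z y) x := by
    refine hf.sp.apply_eq hK (hB y z) (hB z y) (lB y z) (lB z y) fun i a => ?_
    have h2 := hr.irrefl x
    simp only [B, ite_apply, topThree_apply]
    grind
  have := key y z hyx hzx hyz
  have := key z y hzx hyx hyz.symm
  linarith

theorem blockProf_eq_of_ne_right (hf : UnanimousScheme f) (hr : IsPref r) {x x' y : A}
    (hyx : y ≠ x) (hyx' : y ≠ x') (hxx : x ≠ x') {I : Finset (Fin n)} (hI : 2 * #I < n) :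
    f (blockProf r y x I) y = f (blockProf r y x' I) y := by
  have hO : n < 2 * #Iᶜ := by rw [Finset.card_compl, Fintype.card_fin]; omega
  let B : A → A → Prof n A := fun x x' i =>
    if i ∈ I then topThree r y x x' else toBot (topThree r x x' y) y
  have hB : ∀ x x', IsProf (B x x') := fun x x' i => by
    simp only [B]; split_ifs; exacts [hr.topThree _ _ _, (hr.topThree _ _ _).toBot _]
  have key : ∀ x x', y ≠ x → y ≠ x' → x ≠ x' → f (B x x') y = f (blockProf r y x I) y := by
    intro x x' hyx hyx' hxx
    refine hf.apply_eq_blockProf hr (hB x x') (condorcetWinner_of_topOn hO fun i =>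
      ⟨hB x x' i, fun hi a ha => ?_⟩) hyx (fun i hi => ?_) fun i hi z hz => ?_
    · have := Finset.mem_compl.1 hi
      simp only [B, ite_apply, topThree_apply, toBot_apply]
      grind
    · simpa [B, hi] using topRanked_topThree _ _ _ _
    · simp only [B, ite_apply, topThree_apply, toBot_apply]
      grind
  rw [← key x x' hyx hyx' hxx, ← key x' x hyx' hyx hxx.symm]
  refine hf.sp.apply_eq (mem_of_pairOn hf.odd hO (x := x) (y := x')) (hB _ _) (hB _ _)
    (fun i => ⟨hB _ _ i, fun hi z h h' => ?_⟩) (fun i => ⟨hB _ _ i, fun hi z h h' => ?_⟩)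
    fun i a => ?_
  · have := Finset.mem_compl.1 hi
    simp only [B, ite_apply, topThree_apply, toBot_apply]
    grind
  · have := Finset.mem_compl.1 hi
    simp only [B, ite_apply, topThree_apply, toBot_apply]
    grind
  · have h2 := hr.irrefl y
    simp only [B, ite_apply, topThree_apply, toBot_apply]
    grind

end UnanimousScheme

end Weights

section Characterization

variable {n : ℕ} {A : Type*} [Fintype A] {f : Prof n A → A → ℝ} {r : A → A → Prop}

namespace UnanimousScheme

theorem splitProf_congr (hf : UnanimousScheme f) {i : Fin n} {J : Finset (Fin n)}
    (hO : n < 2 * #(insert i J)ᶜ) {x t : A} {p q o p' q' o' : A → A → Prop}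
    (hp : IsPref p) (hq : IsPref q) (ho : IsPref o)
    (hp' : IsPref p') (hq' : IsPref q') (ho' : IsPref o')
    (hx : TopRanked o x) (hx' : TopRanked o' x) (hpp : ∀ a, p a t ↔ p' a t)
    (hqq : ∀ a, q a t ↔ q' a t) (hoo : ∀ a, o a t ↔ o' a t) :
    f (splitProf i J p q o) t = f (splitProf i J p' q' o') t := by
  have hR := isProf_splitProf (i := i) (J := J) hp hq ho
  have hR' := isProf_splitProf (i := i) (J := J) hp' hq' ho'
  refine hf.sp.apply_eq (mem_of_topOn (x := x) hO) hR hR'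
    (fun j => ⟨hR j, fun hj => ?_⟩) (fun j => ⟨hR' j, fun hj => ?_⟩) fun j a => ?_
  · simp only [mem_compl, mem_insert, not_or] at hj
    simpa [splitProf, hj] using hx
  · simp only [mem_compl, mem_insert, not_or] at hj
    simpa [splitProf, hj] using hx'
  · unfold splitProf
    split_ifs
    exacts [hpp a, hqq a, hoo a]

theorem splitProf_eq_zero (hf : UnanimousScheme f) {i : Fin n} {J : Finset (Fin n)}
    (hO : n < 2 * #(insert i J)ᶜ) {x y t : A} {p q o : A → A → Prop}
    (hp : IsPref p) (hq : IsPref q) (ho : IsPref o) (hx : TopRanked o x)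
    (hpy : ∀ z, z ≠ x → z ≠ y → p y z) (hqy : ∀ z, z ≠ x → z ≠ y → q y z)
    (hoy : ∀ z, z ≠ x → z ≠ y → o y z) (htx : t ≠ x) (hty : t ≠ y) :
    f (splitProf i J p q o) t = 0 := by
  have hR := isProf_splitProf (i := i) (J := J) hp hq ho
  refine hf.eq_zero_of_pairOn hR hO (x := x) (y := y) (fun j hj z h h' => ?_) (fun j z h h' => ?_)
    htx hty
  · simp only [mem_compl, mem_insert, not_or] at hj
    simpa [splitProf, hj] using hx z h
  · unfold splitProf
    split_ifs
    exacts [hpy z h h', hqy z h h', hoy z h h']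

theorem splitProf_eq_zero_of_dominated (hf : UnanimousScheme f) {i : Fin n} {J : Finset (Fin n)}
    (hO : n < 2 * #(insert i J)ᶜ) {x t : A} {p q o : A → A → Prop}
    (hp : IsPref p) (hq : IsPref q) (ho : IsPref o) (hx : TopRanked o x)
    (hpt : p x t) (hqt : q x t) (htx : t ≠ x) :
    f (splitProf i J p q o) t = 0 := by
  have hR := isProf_splitProf (i := i) (J := J) hp hq ho
  refine hf.eq_zero_of_condorcetWinner hR (x := x) (condorcetWinner_of_topOn hO fun j =>
    ⟨hR j, fun hj => ?_⟩) (fun j => ?_) htx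
  · simp only [mem_compl, mem_insert, not_or] at hj
    simpa [splitProf, hj] using hx
  · unfold splitProf
    split_ifs
    exacts [hpt, hqt, hx t htx]

theorem blockProf_insert (hf : UnanimousScheme f) (hr : IsPref r) {x y z : A}
    (hyx : y ≠ x) (hzx : z ≠ x) (hyz : y ≠ z) {i : Fin n} {J : Finset (Fin n)} (hi : i ∉ J)
    (hJ : 2 * #(insert i J) < n) :
    f (blockProf r z x (insert i J)) z = f (blockProf r z x {i}) z + f (blockProf r z x J) z := by
  have hO : n < 2 * #(insert i J)ᶜ := by rw [Finset.card_compl, Fintype.card_fin]; omega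
  have hJi : 2 * #({i} : Finset (Fin n)) < n := by
    have := Finset.card_le_card (show ({i} : Finset (Fin n)) ⊆ insert i J by simp)
    omega
  rw [← hf.blockProf_eq_of_ne_left hr hyx hzx hyz hJi]
  have T : ∀ a b c, IsPref (topThree r a b c) := fun a b c => hr.topThree a b c
  have M : ∀ a b c, TopRanked (topThree r a b c) a := topRanked_topThree r
  let F : A → A → A → A → A → A → A → A → A → Prof n A := fun a b c a' b' c' a'' b'' c'' =>
    splitProf i J (topThree r a b c) (topThree r a' b' c') (topThree r a'' b'' c'')
  have E : ∀ {t a b c a' b' c' b'' c'' d e g d' e' g' e'' g''},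
      (∀ s, topThree r a b c s t ↔ topThree r d e g s t) →
      (∀ s, topThree r a' b' c' s t ↔ topThree r d' e' g' s t) →
      (∀ s, topThree r x b'' c'' s t ↔ topThree r x e'' g'' s t) →
      f (F a b c a' b' c' x b'' c'') t = f (F d e g d' e' g' x e'' g'') t :=
    fun h h' h'' => hf.splitProf_congr hO (T _ _ _) (T _ _ _) (T _ _ _) (T _ _ _) (T _ _ _)
      (T _ _ _) (M _ _ _) (M _ _ _) h h' h''
  have hx0 := hr.irrefl x
  have hy0 := hr.irrefl y
  have hz0 := hr.irrefl z
  have S : ∀ {a b c a' b' c' b'' c''},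
      (∀ t, t ≠ x → t ≠ y → t ≠ z → topThree r a b c x t) →
      (∀ t, t ≠ x → t ≠ y → t ≠ z → topThree r a' b' c' x t) →
      f (F a b c a' b' c' x b'' c'') x + f (F a b c a' b' c' x b'' c'') y +
        f (F a b c a' b' c' x b'' c'') z = 1 := fun h h' =>
    hf.sds.add_add_eq_one (splitProf_mem hO (T _ _ _) (T _ _ _) (T _ _ _) (M _ _ _))
      hyx.symm hzx.symm hyz fun t htx hty htz =>
        hf.splitProf_eq_zero_of_dominated hO (T _ _ _) (T _ _ _) (T _ _ _) (M _ _ _)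
          (h t htx hty htz) (h' t htx hty htz) htx
  -- Voter `i` swaps `x` and `z` below `y`; this does not affect the outcome.
  have p0 : f (F y z x z x y x z y) z = f (F y z x z y x x z y) z := by
    apply E <;> intro s <;> simp only [topThree_apply]
    grind
  have q0 : f (F y x z z x y x z y) z = f (F y x z z y x x z y) z := by
    apply E <;> intro s <;> simp only [topThree_apply]
    grind
  have p1 : f (F y z x z y x x z y) x = f (F y z x y z x x y z) x := by
    apply E <;> intro s <;> simp only [topThree_apply] <;> grind
  have q1 : f (F y x z z y x x z y) x = f (F y x z y z x x y z) x := by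
    apply E <;> intro s <;> simp only [topThree_apply] <;> grind
  have y1 : f (F y z x z y x x z y) y = f (F y x z z y x x z y) y := by
    apply E <;> intro s <;> simp only [topThree_apply]
    grind
  have y2 : f (F y z x y z x x y z) y = f (F y x z y z x x y z) y := by
    apply E <;> intro s <;> simp only [topThree_apply]
    grind
  have z2 : f (F y z x y z x x y z) z = 0 := by
    apply hf.splitProf_eq_zero hO (T _ _ _) (T _ _ _) (T _ _ _) (M _ _ _) _ _ _ hzx hyz.symm <;>
      intro t h h' <;> simp only [topThree_apply] <;> grind
  have z2' : f (F y x z y z x x y z) z = 0 := by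
    apply hf.splitProf_eq_zero hO (T _ _ _) (T _ _ _) (T _ _ _) (M _ _ _) _ _ _ hzx hyz.symm <;>
      intro t h h' <;> simp only [topThree_apply] <;> grind
  have sp0 : f (F y z x z x y x z y) x + f (F y z x z x y x z y) y +
      f (F y z x z x y x z y) z = 1 := by
    apply S <;> intro t h h' h'' <;> simp only [topThree_apply] <;> grind
  have sp1 : f (F y z x z y x x z y) x + f (F y z x z y x x z y) y +
      f (F y z x z y x x z y) z = 1 := by
    apply S <;> intro t h h' h'' <;> simp only [topThree_apply] <;> grind
  have sq1 : f (F y x z z y x x z y) x + f (F y x z z y x x z y) y +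
      f (F y x z z y x x z y) z = 1 := by
    apply S <;> intro t h h' h'' <;> simp only [topThree_apply] <;> grind
  have sp2 : f (F y z x y z x x y z) x + f (F y z x y z x x y z) y +
      f (F y z x y z x x y z) z = 1 := by
    apply S <;> intro t h h' h'' <;> simp only [topThree_apply] <;> grind
  have sq2 : f (F y x z y z x x y z) x + f (F y x z y z x x y z) y +
      f (F y x z y z x x y z) z = 1 := by
    apply S <;> intro t h h' h'' <;> simp only [topThree_apply] <;> grind
  -- The two-block profiles in split form.
  have bJ : blockProf r z x J = F x z z z x x x z z := by
    funext j
    by_cases h1 : j = i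
    · subst h1; simp [blockProf, F, splitProf, hi]
    · simp [blockProf, F, splitProf, h1]
  have bi : blockProf r y x {i} = F y x x x y y x y y := by
    funext j
    by_cases h1 : j = i <;> simp [blockProf, F, splitProf, h1]
  have bJi : blockProf r z x (insert i J) = F z x x z x x x z z := by
    funext j
    by_cases h1 : j = i <;> simp [blockProf, F, splitProf, h1]
  have vJ : f (F y x z z x y x z y) z = f (blockProf r z x J) z := by
    have h1 : f (F y x z z x y x z y) z = f (F x y z z x y x z y) z := by
      apply E <;> intro s <;> simp only [topThree_apply]
      grind
    have h2 : f (F x y z z x y x z y) x = f (F x z z z x x x z z) x := by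
      apply E <;> intro s <;> simp only [topThree_apply] <;> grind
    have h3 : f (F x y z z x y x z y) y = 0 := by
      apply hf.splitProf_eq_zero_of_dominated hO (T _ _ _) (T _ _ _) (T _ _ _) (M _ _ _) _ _ hyx <;>
        simp only [topThree_apply] <;> grind
    have h4 : f (F x y z z x y x z y) x + f (F x y z z x y x z y) y +
        f (F x y z z x y x z y) z = 1 := by
      apply S <;> intro t h h' h'' <;> simp only [topThree_apply] <;> grind
    have h5 := hf.blockProf_add hr hzx J
    rw [bJ] at h5 ⊢
    linarith
  have vi : f (F y z x z x y x z y) y = f (blockProf r y x {i}) y := by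
    have h1 : f (F y z x z x y x z y) y = f (F y x z x z y x z y) y := by
      apply E <;> intro s <;> simp only [topThree_apply] <;> grind
    have h2 : f (F y x z x z y x z y) x = f (F y x x x y y x y y) x := by
      apply E <;> intro s <;> simp only [topThree_apply] <;> grind
    have h3 : f (F y x z x z y x z y) z = 0 := by
      apply hf.splitProf_eq_zero_of_dominated hO (T _ _ _) (T _ _ _) (T _ _ _) (M _ _ _) _ _ hzx <;>
        simp only [topThree_apply] <;> grind
    have h4 : f (F y x z x z y x z y) x + f (F y x z x z y x z y) y +
        f (F y x z x z y x z y) z = 1 := by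
      apply S <;> intro t h h' h'' <;> simp only [topThree_apply] <;> grind
    have h5 := hf.blockProf_add hr hyx {i}
    rw [bi] at h5 ⊢
    linarith
  have vJi : f (F y z x z x y x z y) x + f (blockProf r z x (insert i J)) z = 1 := by
    have h1 : f (F y z x z x y x z y) x = f (F z y x z x y x z y) x := by
      apply E <;> intro s <;> simp only [topThree_apply]
      grind
    have h2 : f (F z y x z x y x z y) z = f (F z x x z x x x z z) z := by
      apply E <;> intro s <;> simp only [topThree_apply] <;> grind
    have h3 : f (F z y x z x y x z y) y = 0 := by
      apply hf.splitProf_eq_zero hO (T _ _ _) (T _ _ _) (T _ _ _) (M _ _ _) _ _ _ hyx hyz <;>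
        intro t h h' <;> simp only [topThree_apply] <;> grind
    have h4 : f (F z y x z x y x z y) x + f (F z y x z x y x z y) y +
        f (F z y x z x y x z y) z = 1 := by
      apply S <;> intro t h h' h'' <;> simp only [topThree_apply] <;> grind
    rw [bJi]
    linarith
  linarith

end UnanimousScheme

end Characterization

section Decomposition

variable {n : ℕ} {A : Type*} [Fintype A] {f : Prof n A → A → ℝ} {r : A → A → Prop}

theorem exists_ne_ne_of_three_le_card (hA : 3 ≤ Fintype.card A) (x y : A) :
    ∃ z, z ≠ x ∧ z ≠ y := by
  by_contra! h
  have h1 : (univ : Finset A) ⊆ {x, y} := fun z _ => by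
    by_cases hz : z = x
    · simp [hz]
    · simp [h z hz]
  have h2 := Finset.card_le_card h1
  have h3 := Finset.card_le_two (a := x) (b := y)
  rw [Finset.card_univ] at h2
  omega

namespace UnanimousScheme

theorem blockProf_eq (hf : UnanimousScheme f) (hr : IsPref r) (hA : 3 ≤ Fintype.card A)
    {x y x' y' : A} (hyx : y ≠ x) (hyx' : y' ≠ x') {I : Finset (Fin n)} (hI : 2 * #I < n) :
    f (blockProf r y x I) y = f (blockProf r y' x' I) y' := by
  have left : ∀ {x y z : A}, y ≠ x → z ≠ x →
      f (blockProf r y x I) y = f (blockProf r z x I) z := fun {x y z} hy hz => by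
    by_cases h : y = z
    · rw [h]
    · exact hf.blockProf_eq_of_ne_left hr hy hz h hI
  by_cases hxx : x = x'
  · subst hxx
    exact left hyx hyx'
  obtain ⟨z, hzx, hzx'⟩ := exists_ne_ne_of_three_le_card hA x x'
  rw [left hyx hzx, left hyx' hzx', hf.blockProf_eq_of_ne_right hr hzx hzx' hxx hI]

theorem blockProf_eq_sum (hf : UnanimousScheme f) (hr : IsPref r) (hA : 3 ≤ Fintype.card A)
    {a b : A} (hab : a ≠ b) {x y : A} (hyx : y ≠ x) {I : Finset (Fin n)} (hI : 2 * #I < n) :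
    f (blockProf r y x I) y = ∑ i ∈ I, f (blockProf r a b {i}) a := by
  induction I using Finset.induction_on with
  | empty =>
    have h1 := hf.blockProf_add hr hyx ∅
    have h2 := hf.unanimous _ x (isProf_blockProf hr y x ∅) fun i => by
      simpa [blockProf] using topRanked_topThree _ _ _ _
    rw [Finset.sum_empty]
    linarith
  | insert i J hi ih =>
    obtain ⟨z, hzx, hzy⟩ := exists_ne_ne_of_three_le_card hA x y
    have h1 : #J < #(insert i J) := by simp [hi]
    have h2 : #({i} : Finset (Fin n)) ≤ #(insert i J) := Finset.card_le_card (by simp)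
    rw [hf.blockProf_insert hr hzx hyx hzy hi hI, Finset.sum_insert hi, ih (by omega),
      hf.blockProf_eq hr hA hyx hab (by omega)]

/-- On the Condorcet domain, an alternative that is not the Condorcet winner receives the total
weight of the voters ranking it first. -/
theorem apply_eq_sum_of_ne (hf : UnanimousScheme f) (hr : IsPref r) {γ : Fin n → ℝ}
    (hγ : ∀ i, 0 ≤ γ i)
    (hw : ∀ x y, y ≠ x → ∀ I : Finset (Fin n), 2 * #I < n →
      f (blockProf r y x I) y = ∑ i ∈ I, γ i)
    {R : Prof n A} (hR : IsProf R) {x y : A} (hx : CondorcetWinner R x) (hyx : y ≠ x) :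
    f R y = ∑ i with TopRanked (R i) y, γ i := by
  have hn := (condorcetWinner_iff hR x).1 hx
  have lower : ∀ {Q : Prof n A}, IsProf Q → CondorcetWinner Q x → ∀ t, t ≠ x →
      ∑ i with TopRanked (Q i) t, γ i ≤ f Q t := fun {Q} hQ hx t ht => by
    refine le_trans (le_of_eq ?_) (hf.blockProf_le hr hQ hx ht)
    refine (hw x t ht _ ?_).symm
    have h1 := (condorcetWinner_iff hQ x).1 hx t ht
    have h2 := support_add hQ ht
    have h3 := le_support (R := Q) (O := univ.filter fun i => TopRanked (Q i) t) (x := t) (y := x)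
      fun i hi => (mem_filter.1 hi).2 x ht.symm
    omega
  refine le_antisymm ?_ (lower hR hx y hyx)
  let Ra : Prof n A := fun i => if R i x y then toTop (R i) x else R i
  let R' : Prof n A := fun i => if R i x y then topThree r x y y else
    lexRel (fun t => if TopRanked (R i) t then 0 else if t = y then 1 else if t = x then 2 else 3) r
  have hRa : IsProf Ra := fun i => by
    simp only [Ra]; split_ifs; exacts [(hR i).toTop _, hR i]
  have hR' : IsProf R' := fun i => by
    simp only [R']; split_ifs; exacts [hr.topThree _ _ _, hr.lexRel _]
  have hK := mem_of_lifts hR hx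
  have l0 : ∀ i, Lifts R x i (R i) := fun i => ⟨hR i, fun _ h => h⟩
  have la : ∀ i, Lifts R x i (Ra i) := fun i => ⟨hRa i, fun a h => by
    have := (hR i).irrefl x
    simp only [Ra, ite_apply, toTop_apply]; grind⟩
  have l' : ∀ i, Lifts R x i (R' i) := fun i => ⟨hR' i, fun a h => by
    have h1 := (hR i).irrefl x
    have h2 := (hR i).2.2 x a h
    by_cases hxy : R i x y
    · simp only [R', hxy, if_true]
      exact topRanked_topThree _ _ _ _ _ fun e => h1 (e ▸ h)
    · have h3 : ¬ TopRanked (R i) a := fun ht => h2 (ht x fun e => h1 (by rwa [← e] at h))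
      have h4 : ¬ TopRanked (R i) x := fun ht => hxy (ht y hyx)
      have h5 : a ≠ y := fun e => hxy (e ▸ h)
      have h6 : a ≠ x := fun e => h1 (by rwa [e] at h)
      simp only [R', hxy, if_false]
      refine Or.inl ?_
      simp [h3, h4, h5, h6, hyx.symm]⟩
  have hxR' := condorcetWinner_of_lifts hR hx l'
  have e1 : f R y = f Ra y := hf.sp.apply_eq hK hR hRa l0 la fun i a => by
    have := (hR i).irrefl y
    simp only [Ra, ite_apply, toTop_apply]; grind
  have top_ne : ∀ i, ¬ R i x y → ∀ t, TopRanked (R i) t → TopRanked (R' i) t := by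
    intro i hxy t ht s hs
    have h1 : ¬ TopRanked (R i) s := fun h => hs ((hR i).topRanked_unique h ht)
    simp only [R', hxy, if_false]
    refine Or.inl ?_
    simp only [ht, h1, if_true, if_false]
    split_ifs <;> simp
  have e2 : f Ra y ≤ f R' y := by
    refine hf.sp.apply_le hK hR' hRa l' la fun i a ha b hb => ?_
    by_cases hxy : R i x y
    · simp only [R', Ra, hxy, if_true, topThree_apply, toTop_apply] at ha hb ⊢
      have := (hR i).irrefl x
      have := hr.irrefl y
      grind
    · exfalso
      simp only [Ra, hxy, if_false] at hb
      have hat : TopRanked (R i) a := by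
        by_contra h
        have h1 := hr.irrefl y
        simp only [R', hxy, if_false, lexRel, h] at ha
        grind
      exact (hR i).2.2 _ _ hb (hat b fun e => (hR i).irrefl a (e ▸ hb))
  let O : Finset (Fin n) := {i | R i x y}
  have hO : n < 2 * #O := hn y hyx
  have hxO : 1 - ∑ i ∈ Oᶜ, γ i ≤ f R' x := by
    have h1 := hf.blockProf_le_of_topOn hr hR' hyx hO fun i hi => by
      have : R i x y := by simpa [O] using hi
      simpa [R', this] using topRanked_topThree _ _ _ _
    have h2 := hf.blockProf_add hr hyx.symm O
    have h0 := hf.odd.pos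
    have h3 := hw x y hyx Oᶜ (by rw [Finset.card_compl, Fintype.card_fin]; omega)
    rw [← blockProf_compl, compl_compl] at h3
    linarith
  have hsum := (hf.sds R' (hK _ l')).2
  rw [← Finset.add_sum_erase _ _ (mem_univ x),
    ← Finset.add_sum_erase _ _ (mem_erase.2 ⟨hyx, mem_univ y⟩)] at hsum
  have hrest : ∑ t ∈ (univ.erase x).erase y, ∑ i with TopRanked (R' i) t, γ i ≤
      ∑ t ∈ (univ.erase x).erase y, f R' t :=
    Finset.sum_le_sum fun t ht => lower hR' hxR' t (mem_erase.1 (mem_erase.1 ht).2).1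
  have hall : ∑ i ∈ Oᶜ, γ i ≤ ∑ t ∈ univ.erase x, ∑ i with TopRanked (R' i) t, γ i := by
    simp only [Finset.sum_filter]
    rw [Finset.sum_comm]
    have hnn : ∀ i t, 0 ≤ if TopRanked (R' i) t then γ i else 0 := fun i t => by
      split_ifs; exacts [hγ i, le_rfl]
    refine le_trans (Finset.sum_le_sum fun i hi => ?_)
      (Finset.sum_le_sum_of_subset_of_nonneg (Finset.subset_univ Oᶜ)
        fun i _ _ => Finset.sum_nonneg fun t _ => hnn i t)
    have hxy : ¬ R i x y := by simpa [O] using hi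
    have : Nonempty A := ⟨x⟩
    obtain ⟨t, ht⟩ := (hR i).exists_topRanked
    have htx : t ≠ x := fun e => hxy ((e ▸ ht) y hyx)
    have := Finset.single_le_sum (f := fun t => if TopRanked (R' i) t then γ i else 0)
      (fun t _ => hnn i t) (mem_erase.2 ⟨htx, mem_univ t⟩)
    simpa [top_ne i hxy t ht] using this
  rw [← Finset.add_sum_erase _ _ (mem_erase.2 ⟨hyx, mem_univ y⟩)] at hall
  have hy : ∑ i with TopRanked (R' i) y, γ i ≤ ∑ i with TopRanked (R i) y, γ i := by
    refine Finset.sum_le_sum_of_subset_of_nonneg (fun i hi => ?_) fun i _ _ => hγ i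
    have hi' : TopRanked (R' i) y := by simpa using hi
    have hxy : ¬ R i x y := fun hxy => by
      simp only [R', hxy, if_true] at hi'
      exact hyx ((hr.topThree x y y).topRanked_unique hi' (topRanked_topThree _ _ _ _))
    have : Nonempty A := ⟨x⟩
    obtain ⟨t, ht⟩ := (hR i).exists_topRanked
    have := (hR' i).topRanked_unique hi' (top_ne i hxy t ht)
    simpa [this] using ht
  linarith

end UnanimousScheme

theorem isSDS_condRule : IsSDS (CondorcetDomain n A) CondRule := by
  rintro R ⟨-, x, hx⟩
  refine ⟨fun y => ?_, ?_⟩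
  · unfold CondRule
    split_ifs <;> norm_num
  · rw [Finset.sum_eq_single x]
    · simp [CondRule, hx]
    · intro y _ hy
      exact if_neg fun h => hy (condorcetWinner_unique h hx)
    · simp

theorem mass_condRule {R : Prof n A} {x : A} (hx : CondorcetWinner R x) (S : Set A) :
    mass (CondRule R) S = if x ∈ S then 1 else 0 := by
  unfold mass
  rw [Finset.sum_eq_single x]
  · simp [Set.indicator, CondRule, hx]
  · intro y _ hy
    have : ¬ CondorcetWinner R y := fun h => hy (condorcetWinner_unique h hx)
    simp [Set.indicator, CondRule, this]
  · simp

theorem strategyproof_condRule : Strategyproof (CondorcetDomain n A) CondRule := by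
  rintro R ⟨hR, x, hx⟩ R' ⟨hR', x', hx'⟩ i hi a
  rw [mass_condRule hx, mass_condRule hx']
  suffices h : x' ∈ UC (R i) a → x ∈ UC (R i) a by
    split_ifs with h1 h2 <;> norm_num
    exact h2 (h h1)
  intro h
  by_cases hxx : x = x'
  · rwa [hxx]
  have hxx' : R i x x' := by
    by_contra hno
    have h1 := (condorcetWinner_iff hR x).1 hx x' (Ne.symm hxx)
    have h2 := (condorcetWinner_iff hR' x').1 hx' x hxx
    have h3 := support_add hR' hxx
    have h4 : support R x x' ≤ support R' x x' := by
      refine le_support fun j hj => ?_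
      have hj' : R j x x' := by simpa using hj
      rwa [← hi j fun e => hno (e ▸ hj')]
    omega
  rcases h with h | rfl
  · exact Or.inl ((hR i).2.1 _ _ _ hxx' h)
  · exact Or.inl hxx'

theorem sum_dict [Nonempty A] {R : Prof n A} (hR : IsProf R) (i : Fin n) :
    ∑ x, dict i R x = 1 := by
  obtain ⟨t, ht⟩ := (hR i).exists_topRanked
  rw [Finset.sum_eq_single t]
  · simp [dict, ht]
  · intro y _ hy
    exact if_neg fun h => hy ((hR i).topRanked_unique h ht)
  · simp

/-- Every strategyproof and non-imposing social decision scheme on the Condorcet domain is an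
affine combination of dictatorships and the Condorcet rule. -/
theorem exists_weights (hn : 3 ≤ n) (hodd : Odd n) (hA : 3 ≤ Fintype.card A)
    (hf : IsSDS (CondorcetDomain n A) f) (hsp : Strategyproof (CondorcetDomain n A) f)
    (hni : NonImposing (CondorcetDomain n A) f) :
    ∃ γ : Fin n → ℝ, (∀ i, 0 ≤ γ i) ∧ ∀ R ∈ CondorcetDomain n A, ∀ x,
      f R x = ∑ i, γ i * dict i R x + (1 - ∑ i, γ i) * CondRule R x := by
  have hu := UnanimousScheme.of_nonImposing hn hodd hf hsp hni
  obtain ⟨a, b, hab⟩ : ∃ a b : A, a ≠ b :=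
    Fintype.exists_pair_of_one_lt_card (by omega)
  obtain ⟨R₀, ⟨hR₀, -⟩, -⟩ := hni a
  have hr := hR₀ ⟨0, by omega⟩
  have : Nonempty A := ⟨a⟩
  set r := R₀ ⟨0, by omega⟩
  have hγ : ∀ i, 0 ≤ f (blockProf r a b {i}) a := fun i =>
    (hf _ (hu.blockProf_mem hr a b {i})).1 a
  refine ⟨fun i => f (blockProf r a b {i}) a, hγ, ?_⟩
  rintro R ⟨hR, x, hx⟩
  have hne : ∀ y, y ≠ x → f R y = ∑ i, f (blockProf r a b {i}) a * dict i R y := fun y hy => by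
    rw [hu.apply_eq_sum_of_ne hr hγ (fun x y hyx I hI => hu.blockProf_eq_sum hr hA hab hyx hI)
      hR hx hy, Finset.sum_filter]
    simp [dict]
  intro y
  by_cases hy : y = x
  · subst hy
    have h1 := (hf R ⟨hR, y, hx⟩).2
    have h2 : ∑ z, ∑ i, f (blockProf r a b {i}) a * dict i R z =
        ∑ i, f (blockProf r a b {i}) a := by
      rw [Finset.sum_comm]
      simp [← Finset.mul_sum, sum_dict hR]
    rw [← Finset.add_sum_erase _ _ (mem_univ y)] at h1 h2
    rw [Finset.sum_congr rfl fun z hz => hne z (mem_erase.1 hz).1] at h1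
    simp only [CondRule, hx, if_true]
    linarith
  · have hny : ¬ CondorcetWinner R y := fun h => hy (condorcetWinner_unique h hx)
    simp [CondRule, hny, hne y hy]

end Decomposition

/-- For odd `n ≥ 3`, the Condorcet rule is the only strategyproof,
non-imposing, and 0-randomly dictatorial SDS on the Condorcet domain. -/
theorem condRule_unique_zero_randomly_dictatorial {n : ℕ} {A : Type*} [Fintype A]
    (hn : 3 ≤ n) (hodd : Odd n) (hA : 3 ≤ Fintype.card A)
    (f : Prof n A → A → ℝ) (hf : IsSDS (CondorcetDomain n A) f)
    (hsp : Strategyproof (CondorcetDomain n A) f)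
    (hni : NonImposing (CondorcetDomain n A) f)
    (h0rd : ¬ ∃ (γ : ℝ) (w : Fin n → ℝ) (g : Prof n A → A → ℝ),
        0 < γ ∧ (∀ i, 0 ≤ w i) ∧ ∑ i, w i = 1 ∧
        IsSDS (CondorcetDomain n A) g ∧ Strategyproof (CondorcetDomain n A) g ∧
        ∀ R ∈ CondorcetDomain n A, ∀ x,
          f R x = γ * (∑ i, w i * dict i R x) + (1 - γ) * g R x) :
    ∀ R ∈ CondorcetDomain n A, ∀ x, f R x = CondRule R x := by
  obtain ⟨γ, hγ, h⟩ := exists_weights hn hodd hA hf hsp hni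
  have hsum : ∑ i, γ i = 0 := by
    by_contra hne
    have hpos : 0 < ∑ i, γ i := lt_of_le_of_ne (Finset.sum_nonneg fun i _ => hγ i) (Ne.symm hne)
    refine h0rd ⟨∑ i, γ i, fun i => γ i / ∑ j, γ j, CondRule, hpos,
      fun i => div_nonneg (hγ i) hpos.le, ?_, isSDS_condRule, strategyproof_condRule,
      fun R hR x => ?_⟩
    · rw [← Finset.sum_div, div_self hne]
    · rw [h R hR x, Finset.mul_sum]
      congr 1
      refine Finset.sum_congr rfl fun i _ => ?_
      rw [← mul_assoc, mul_div_cancel₀ _ hne]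
  intro R hR x
  have h0 : ∀ i, γ i = 0 := fun i =>
    (Finset.sum_eq_zero_iff_of_nonneg fun i _ => hγ i).1 hsum i (mem_univ i)
  simp [h R hR x, h0]
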